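/- arXiv:math/0111245 — 6 statements merged into one kernel-verified Lean document; each statement's English description precedes it below -/
import Mathlib

section
/- Let s ∈ GL(2, ℤ) with s² = I and s ≠ ±I, let t ∈ ℝ² with s·t + t ∈ ℤ², and let σ : ℝ²/ℤ² → ℝ²/ℤ² be the involution induced by v ↦ s·v + t. If σ has no fixed points, then σ is conjugate to the map induced by (x, y) ↦ (x + 1/2, −y); that is, there exist g ∈ GL(2, ℤ) and c ∈ ℝ² such that, with h : ℝ²/ℤ² → ℝ²/ℤ² the homeomorphism induced by v ↦ g·v + c, one has h ∘ σ ∘ h⁻¹ equal to the map induced by (x, y) ↦ (x + 1/2, −y). -/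
/-- The lattice of integer-valued vectors inside `ι → ℝ`. -/
def intLat (ι : Type*) : AddSubgroup (ι → ℝ) where
  carrier := {v | ∀ i, ∃ m : ℤ, v i = (m : ℝ)}
  zero_mem' := fun i => ⟨0, by simp⟩
  add_mem' := by
    intro x y hx hy i
    obtain ⟨m, hm⟩ := hx i
    obtain ⟨k, hk⟩ := hy i
    exact ⟨m + k, by simp [hm, hk]⟩
  neg_mem' := by
    intro x hx i
    obtain ⟨m, hm⟩ := hx i
    exact ⟨-m, by simp [hm]⟩

/-- The real 2-torus `ℝ²/ℤ²`. -/
abbrev Torus2 := (Fin 2 → ℝ) ⧸ intLat (Fin 2)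

theorem mulVec_mem_intLat {ι : Type*} [Fintype ι] (A : Matrix ι ι ℤ) {v : ι → ℝ}
    (hv : v ∈ intLat ι) : (A.map (Int.cast : ℤ → ℝ)).mulVec v ∈ intLat ι := by
  choose m hm using hv
  intro i
  exact ⟨∑ j, A i j * m j, by simp [Matrix.mulVec, dotProduct, hm]⟩

/-- The endomorphism of the torus `ℝ^ι/ℤ^ι` induced by an integral matrix. -/
def torusHom {ι : Type*} [Fintype ι] (A : Matrix ι ι ℤ) :
    (ι → ℝ) ⧸ intLat ι →+ (ι → ℝ) ⧸ intLat ι :=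
  QuotientAddGroup.map _ _ (Matrix.mulVecLin (A.map (Int.cast : ℤ → ℝ))).toAddMonoidHom
    fun _ hv => mulVec_mem_intLat A hv

theorem torusHom_mk {ι : Type*} [Fintype ι] (A : Matrix ι ι ℤ) (v : ι → ℝ) :
    torusHom A (QuotientAddGroup.mk v) =
      QuotientAddGroup.mk ((A.map (Int.cast : ℤ → ℝ)).mulVec v) :=
  rfl

theorem continuous_torusHom {ι : Type*} [Fintype ι] (A : Matrix ι ι ℤ) :
    Continuous (torusHom A) := by
  refine isQuotientMap_quotient_mk'.continuous_iff.2 ?_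
  exact QuotientAddGroup.continuous_mk.comp (Continuous.matrix_mulVec continuous_const continuous_id)

theorem map_intCast_mul_eq_one {ι : Type*} [Fintype ι] [DecidableEq ι] {A B : Matrix ι ι ℤ}
    (hAB : A * B = 1) : A.map (Int.cast : ℤ → ℝ) * B.map (Int.cast : ℤ → ℝ) = 1 := by
  have h := congrArg (Int.castRingHom ℝ).mapMatrix hAB
  rwa [map_mul, map_one] at h

theorem torusHom_torusHom_of_mul_eq_one {ι : Type*} [Fintype ι] [DecidableEq ι]
    {A B : Matrix ι ι ℤ} (hAB : A * B = 1) (p : (ι → ℝ) ⧸ intLat ι) :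
    torusHom A (torusHom B p) = p := by
  induction p using QuotientAddGroup.induction_on with
  | H v =>
    rw [torusHom_mk, torusHom_mk, Matrix.mulVec_mulVec, map_intCast_mul_eq_one hAB,
      Matrix.one_mulVec]

/-- The homeomorphism of the torus induced by an invertible integral affine map. -/
def torusAffineHomeomorph {ι : Type*} [Fintype ι] [DecidableEq ι] (A B : Matrix ι ι ℤ)
    (hAB : A * B = 1) (hBA : B * A = 1) (c : ι → ℝ) :
    ((ι → ℝ) ⧸ intLat ι) ≃ₜ ((ι → ℝ) ⧸ intLat ι) :=
  Homeomorph.trans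
    { toFun := torusHom A
      invFun := torusHom B
      left_inv := torusHom_torusHom_of_mul_eq_one hBA
      right_inv := torusHom_torusHom_of_mul_eq_one hAB
      continuous_toFun := continuous_torusHom A
      continuous_invFun := continuous_torusHom B }
    (Homeomorph.addRight (QuotientAddGroup.mk c))

theorem torusAffineHomeomorph_mk {ι : Type*} [Fintype ι] [DecidableEq ι] (A B : Matrix ι ι ℤ)
    (hAB : A * B = 1) (hBA : B * A = 1) (c v : ι → ℝ) :
    torusAffineHomeomorph A B hAB hBA c (QuotientAddGroup.mk v) =
      QuotientAddGroup.mk ((A.map (Int.cast : ℤ → ℝ)).mulVec v + c) :=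
  rfl

theorem trace_eq_zero_of_mul_self_eq_one {s : Matrix (Fin 2) (Fin 2) ℤ}
    (hs2 : s * s = 1) (hs1 : s ≠ 1) (hsneg : s ≠ -1) : s 1 1 = -s 0 0 := by
  have h00 := congrFun (congrFun hs2 0) 0
  have h01 := congrFun (congrFun hs2 0) 1
  have h10 := congrFun (congrFun hs2 1) 0
  have h11 := congrFun (congrFun hs2 1) 1
  simp [Matrix.mul_apply, Fin.sum_univ_two] at h00 h01 h10 h11
  by_contra hne
  have htr : s 0 0 + s 1 1 ≠ 0 := fun h => hne (by linarith)
  have hb : s 0 1 = 0 := (mul_eq_zero.1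
    (show s 0 1 * (s 0 0 + s 1 1) = 0 by linear_combination h01)).resolve_right htr
  have hc : s 1 0 = 0 := (mul_eq_zero.1
    (show s 1 0 * (s 0 0 + s 1 1) = 0 by linear_combination h10)).resolve_right htr
  have hda : s 0 0 = s 1 1 := sub_eq_zero.1 ((mul_eq_zero.1
    (show (s 0 0 - s 1 1) * (s 0 0 + s 1 1) = 0 by
      linear_combination h00 - h11)).resolve_right htr)
  rw [hb, zero_mul, add_zero] at h00
  rcases mul_self_eq_one_iff.1 h00 with h | h
  · exact hs1 (by ext i j; fin_cases i <;> fin_cases j <;> simp [hb, hc, ← hda, h])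
  · exact hsneg (by ext i j; fin_cases i <;> fin_cases j <;> simp [hb, hc, ← hda, h])

/-- The `-1`-eigenspace of an integral involution `s ≠ 1`, acting on row vectors, contains a
primitive vector. -/
theorem exists_isCoprime_row_mul_eq_neg {s : Matrix (Fin 2) (Fin 2) ℤ}
    (hs2 : s * s = 1) (hs1 : s ≠ 1) :
    ∃ p q : ℤ, IsCoprime p q ∧ p * s 0 0 + q * s 1 0 = -p ∧ p * s 0 1 + q * s 1 1 = -q := by
  obtain ⟨i, hi⟩ : ∃ i, (s - 1) i 0 ≠ 0 ∨ (s - 1) i 1 ≠ 0 := by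
    by_contra! h
    refine hs1 (sub_eq_zero.1 ?_)
    ext i j
    fin_cases j
    exacts [(h i).1, (h i).2]
  have hs : (s - 1) * s = -(s - 1) := by rw [sub_mul, hs2, one_mul, neg_sub]
  have h0 := congrFun (congrFun hs i) 0
  have h1 := congrFun (congrFun hs i) 1
  rw [Matrix.mul_apply, Fin.sum_univ_two, Matrix.neg_apply] at h0 h1
  generalize (s - 1) i 0 = P at *
  generalize (s - 1) i 1 = Q at *
  obtain ⟨p, q, hpq, hP, hQ⟩ : ∃ p q : ℤ, IsCoprime p q ∧
      P = p * (Int.gcd P Q : ℤ) ∧ Q = q * (Int.gcd P Q : ℤ) := by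
    obtain ⟨p, q, h, hP, hQ⟩ := Int.exists_gcd_one (m := P) (n := Q) (by
      rcases hi with hi | hi
      · exact Int.gcd_pos_of_ne_zero_left _ hi
      · exact Int.gcd_pos_of_ne_zero_right _ hi)
    exact ⟨p, q, Int.isCoprime_iff_gcd_eq_one.2 h, hP, hQ⟩
  have hd : (Int.gcd P Q : ℤ) ≠ 0 := by
    intro h
    rw [h, mul_zero] at hP hQ
    exact hi.elim (· hP) (· hQ)
  generalize (Int.gcd P Q : ℤ) = d at *
  subst hP hQ
  exact ⟨p, q, hpq, mul_left_cancel₀ hd (by linear_combination h0),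
    mul_left_cancel₀ hd (by linear_combination h1)⟩

/-- Let `s ∈ GL(2,ℤ)` with `s² = I`, `s ≠ ±I`, and let `σ` be the involution of the
torus `ℝ²/ℤ²` induced by `v ↦ s·v + t` (where `s·t + t ∈ ℤ²`).  If `σ` has no fixed
point then `σ` is conjugate, by a homeomorphism `h` induced by an integral affine map
`v ↦ g·v + c` with `g ∈ GL(2,ℤ)`, to the involution induced by `(x,y) ↦ (x + 1/2, -y)`. -/
theorem fixed_point_free_affine_involution_normal_form
    (s : Matrix (Fin 2) (Fin 2) ℤ) (hdet : IsUnit s.det)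
    (hs2 : s * s = 1) (hs1 : s ≠ 1) (hsneg : s ≠ -1)
    (t : Fin 2 → ℝ)
    (ht : (s.map (Int.cast : ℤ → ℝ)).mulVec t + t ∈ intLat (Fin 2))
    (σ : Torus2 → Torus2)
    (hσ : ∀ v : Fin 2 → ℝ, σ (QuotientAddGroup.mk v) =
      QuotientAddGroup.mk ((s.map (Int.cast : ℤ → ℝ)).mulVec v + t))
    (hfree : ∀ p : Torus2, σ p ≠ p) :
    ∃ (g : Matrix (Fin 2) (Fin 2) ℤ) (c : Fin 2 → ℝ) (h : Torus2 ≃ₜ Torus2)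
      (σ₀ : Torus2 → Torus2),
      IsUnit g.det ∧
      (∀ v : Fin 2 → ℝ, h (QuotientAddGroup.mk v) =
        QuotientAddGroup.mk ((g.map (Int.cast : ℤ → ℝ)).mulVec v + c)) ∧
      (∀ v : Fin 2 → ℝ, σ₀ (QuotientAddGroup.mk v) =
        QuotientAddGroup.mk ![v 0 + 1 / 2, -(v 1)]) ∧
      ∀ p : Torus2, h (σ (h.symm p)) = σ₀ p := by
  have htr := trace_eq_zero_of_mul_self_eq_one hs2 hs1 hsneg
  obtain ⟨p, q, ⟨x, y, hxy⟩, hp, hq⟩ := exists_isCoprime_row_mul_eq_neg hs2 hs1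
  have hs : s = !![s 0 0, s 0 1; s 1 0, s 1 1] := Matrix.eta_fin_two s
  rw [htr] at hs hq
  generalize s 0 0 = a at *
  generalize s 0 1 = b at *
  generalize s 1 0 = c at *
  clear hs1 hsneg htr hs2 hdet
  subst hs
  -- With respect to the rows `(y, -x)`, `(p, q)` the matrix becomes `!![1, k; 0, -1]`.
  obtain ⟨k, hk⟩ : ∃ k : ℤ, (y * a - x * c) * x + (y * b + x * a) * y = k := ⟨_, rfl⟩
  have hα : (y * a - x * c) * q - (y * b + x * a) * p = 1 := by
    linear_combination (-x) * hp - y * hq + hxy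
  have hρ0 : y * a - x * c = y + k * p := by
    linear_combination (-(y * a - x * c)) * hxy + y * hα + p * hk
  have hρ1 : y * b + x * a = -x + k * q := by
    linear_combination (-(y * b + x * a)) * hxy - x * hα + q * hk
  have hw0 : a * x + b * y = k * q - x := by
    linear_combination (-(a * x + b * y)) * hxy + x * (x * hp + y * hq - hxy) + q * hk
  have hw1 : c * x - a * y = -k * p - y := by
    linear_combination (-(c * x - a * y)) * hxy + y * (x * hp + y * hq - hxy) - p * hk
  have hxyR : (x : ℝ) * p + y * q = 1 := by exact_mod_cast hxy
  have hpR : (p : ℝ) * a + q * c = -p := by exact_mod_cast hp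
  have hqR : (p : ℝ) * b + q * -a = -q := by exact_mod_cast hq
  have hρ0R : (y : ℝ) * a - x * c = y + k * p := by exact_mod_cast hρ0
  have hρ1R : (y : ℝ) * b + x * a = -x + k * q := by exact_mod_cast hρ1
  have hw0R : (a : ℝ) * x + b * y = k * q - x := by exact_mod_cast hw0
  have hw1R : (c : ℝ) * x - a * y = -k * p - y := by exact_mod_cast hw1
  obtain ⟨n, hn⟩ : ∃ n : ℤ, 2 * (y * t 0 - x * t 1) + k * (p * t 0 + q * t 1) = (n : ℝ) := by
    obtain ⟨m₀, hm₀⟩ := ht 0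
    obtain ⟨m₁, hm₁⟩ := ht 1
    simp at hm₀ hm₁
    refine ⟨y * m₀ - x * m₁, ?_⟩
    push_cast
    linear_combination y * hm₀ - x * hm₁ - t 0 * hρ0R - t 1 * hρ1R
  have hodd (m : ℤ) : Odd (n + k * m) := by
    rw [← Int.not_even_iff_odd]
    rintro ⟨e, he⟩
    have heR : (n : ℝ) + k * m = e + e := by exact_mod_cast he
    set Y : ℝ := (p * t 0 + q * t 1 + m) / 2 with hY
    have hY2 : 2 * Y = p * t 0 + q * t 1 + m := by rw [hY]; ring
    refine hfree (QuotientAddGroup.mk ![x * Y, y * Y]) ?_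
    rw [hσ]
    refine (QuotientAddGroup.eq_iff_sub_mem).2 fun i => ?_
    fin_cases i
    · refine ⟨q * e - x * m, ?_⟩
      simp [Matrix.vecHead, Matrix.vecTail]
      linear_combination Y * hw0R - t 0 * hxyR + (k * q / 2 - x) * hY2 + q / 2 * (hn + heR)
    · refine ⟨-(p * e) - y * m, ?_⟩
      simp [Matrix.vecHead, Matrix.vecTail]
      linear_combination Y * hw1R - t 1 * hxyR + (-k * p / 2 - y) * hY2 - p / 2 * (hn + heR)
  obtain ⟨l, hl⟩ : Odd n := by simpa using hodd 0
  obtain ⟨j, hj⟩ : Even k := by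
    have := hodd 1
    rw [mul_one, Int.odd_add] at this
    exact this.1 ⟨l, hl⟩
  have hlR : (n : ℝ) = 2 * l + 1 := by exact_mod_cast hl
  have hjR : (k : ℝ) = j + j := by exact_mod_cast hj
  set g : Matrix (Fin 2) (Fin 2) ℤ := !![y + j * p, -x + j * q; p, q] with hg
  have hdet : g.det = 1 := by
    rw [hg, Matrix.det_fin_two_of]
    linear_combination hxy
  have hgl : g * g.adjugate = 1 := by rw [Matrix.mul_adjugate, hdet, one_smul]
  have hgr : g.adjugate * g = 1 := by rw [Matrix.adjugate_mul, hdet, one_smul]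
  set d : Fin 2 → ℝ := ![0, -(p * t 0 + q * t 1) / 2] with hd
  let h : Torus2 ≃ₜ Torus2 := torusAffineHomeomorph g g.adjugate hgl hgr d
  have hh (v : Fin 2 → ℝ) : h (QuotientAddGroup.mk v) =
      QuotientAddGroup.mk ((g.map (Int.cast : ℤ → ℝ)).mulVec v + d) :=
    torusAffineHomeomorph_mk g g.adjugate hgl hgr d v
  have hconj (v : Fin 2 → ℝ) : h (σ (QuotientAddGroup.mk v)) = QuotientAddGroup.mk
      ![((g.map (Int.cast : ℤ → ℝ)).mulVec v + d) 0 + 1 / 2,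
        -((g.map (Int.cast : ℤ → ℝ)).mulVec v + d) 1] := by
    rw [hσ, hh]
    refine (QuotientAddGroup.eq_iff_sub_mem).2 fun i => ?_
    fin_cases i
    · refine ⟨l, ?_⟩
      simp [Matrix.vecHead, Matrix.vecTail, hg, hd]
      linear_combination v 0 * (hρ0R + j * hpR) + v 1 * (hρ1R + j * hqR) + hn / 2 + hlR / 2
        + (v 0 * p + v 1 * q - (p * t 0 + q * t 1) / 2) * hjR
    · refine ⟨0, ?_⟩
      simp [Matrix.vecHead, Matrix.vecTail, hg, hd]
      linear_combination v 0 * hpR + v 1 * hqR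
  refine ⟨g, d, h, fun P => h (σ (h.symm P)), by simp [hdet], hh, fun v => ?_, fun _ => rfl⟩
  obtain ⟨w, hw⟩ : ∃ w, (g.map (Int.cast : ℤ → ℝ)).mulVec w + d = v := by
    refine ⟨(g.adjugate.map (Int.cast : ℤ → ℝ)).mulVec (v - d), ?_⟩
    have hmul : g.map (Int.cast : ℤ → ℝ) * g.adjugate.map (Int.cast : ℤ → ℝ) = 1 :=
      map_intCast_mul_eq_one hgl
    rw [Matrix.mulVec_mulVec, hmul, Matrix.one_mulVec, sub_add_cancel]
  have hsymm : h.symm (QuotientAddGroup.mk v) = QuotientAddGroup.mk w := by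
    rw [Homeomorph.symm_apply_eq, hh, hw]
  simp only [hsymm, hconj, hw]
end

section
/- Fix nonnegative integers r, k⁺, k⁻ and set n = 2r + k⁺ + k⁻. Define s ∈ GL(n, ℤ) on (u, v, w⁺, w⁻) ∈ ℤ^r × ℤ^r × ℤ^{k⁺} × ℤ^{k⁻} by s(u, v, w⁺, w⁻) = (v, u, w⁺, −w⁻). Let b ∈ ℝⁿ satisfy s·b + b ∈ ℤⁿ, and let σ_b : ℝⁿ/ℤⁿ → ℝⁿ/ℤⁿ be the involution induced by x ↦ s·x + b. Then there exist λ ∈ ℤⁿ, c ∈ ℝⁿ, and g ∈ GL(n, ℤ) commuting with s, such that b' := g·(b + λ + s·c − c) is either equal to 0, or k⁺ ≥ 1 and b' = (0, 0, (1/2)e₁, 0), where e₁ is the first standard basis vector of the w⁺-block. Moreover, the first normal form occurs if and only if σ_b has a fixed point on ℝⁿ/ℤⁿ, and in the second case σ_b is fixed-point free. -/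
/-- Index type for `ℤⁿ = ℤ^r × ℤ^r × ℤ^{k⁺} × ℤ^{k⁻}`, `n = 2r + k⁺ + k⁻`. -/
abbrev BIdx (r kp km : ℕ) := (Fin r ⊕ Fin r) ⊕ (Fin kp ⊕ Fin km)

/-- The integral involution `s(u, v, w⁺, w⁻) = (v, u, w⁺, -w⁻)`, as a matrix. -/
def sMat (r kp km : ℕ) : Matrix (BIdx r kp km) (BIdx r kp km) ℤ :=
  Matrix.fromBlocks (Matrix.fromBlocks 0 1 1 0) 0 0 (Matrix.fromBlocks 1 0 0 (-1))

/-- The vector `(0, 0, (1/2)e₁, 0)` where `e₁` is the first basis vector of the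
`w⁺`-block. -/
noncomputable def halfE1 (r kp km : ℕ) : BIdx r kp km → ℝ := fun i =>
  match i with
  | Sum.inr (Sum.inl j) => if (j : ℕ) = 0 then 1 / 2 else 0
  | _ => 0

/-- The n-torus `ℝⁿ/ℤⁿ` with the block index set. -/
abbrev TorusB (r kp km : ℕ) := (BIdx r kp km → ℝ) ⧸ intLat (BIdx r kp km)

open Matrix in
/-- An integer vector with some coordinate equal to `1` can be moved to any standard basis vector
by a unimodular matrix. -/
theorem exists_isUnit_det_mulVec_eq_single {ι : Type*} [Fintype ι] [DecidableEq ι]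
    (x : ι → ℤ) (i j : ι) (hj : x j = 1) :
    ∃ h : Matrix ι ι ℤ, IsUnit h.det ∧ h *ᵥ x = Pi.single i 1 := by
  set f : ι → ℤ := Pi.single j (1 - x i) + Pi.single i 1 with hf
  have hfx : f ⬝ᵥ x = 1 := by simp [hf, add_dotProduct, hj]
  have hfi : f ⬝ᵥ Pi.single i 1 = 1 := by
    rcases eq_or_ne i j with rfl | hij
    · simp [hf, hj]
    · simp [hf, hij]
  have hfd : f ⬝ᵥ (x - Pi.single i 1) = 0 := by rw [dotProduct_sub, hfx, hfi, sub_self]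
  refine ⟨1 - vecMulVec (x - Pi.single i 1) f, ?_, ?_⟩
  · refine (isUnit_iff_isUnit_det _).mp (.of_mul_eq_one (1 + vecMulVec (x - Pi.single i 1) f) ?_)
    rw [sub_mul, mul_add, mul_add, vecMulVec_mul_vecMulVec, hfd]
    simp
  · rw [sub_mulVec, vecMulVec_mulVec, hfx]
    simp

open Matrix in
theorem sMat_map_mulVec (r kp km : ℕ) (v : BIdx r kp km → ℝ) :
    (sMat r kp km).map (Int.cast : ℤ → ℝ) *ᵥ v =
      Sum.elim (Sum.elim (fun i => v (.inl (.inr i))) (fun i => v (.inl (.inl i))))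
        (Sum.elim (fun i => v (.inr (.inl i))) (fun i => -v (.inr (.inr i)))) := by
  ext ((i | i) | (i | i)) <;>
    simp [sMat, mulVec, dotProduct, Fintype.sum_sum_type, Matrix.one_apply, apply_ite]

open Matrix in
theorem commute_sMat_fromBlocks (r kp km : ℕ) (h : Matrix (Fin kp) (Fin kp) ℤ) :
    fromBlocks (1 : Matrix (Fin r ⊕ Fin r) (Fin r ⊕ Fin r) ℤ) 0 0
        (fromBlocks h 0 0 (1 : Matrix (Fin km) (Fin km) ℤ)) * sMat r kp km =
      sMat r kp km * fromBlocks 1 0 0 (fromBlocks h 0 0 1) := by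
  simp [sMat, fromBlocks_multiply]

theorem mem_intLat {ι : Type*} {v : ι → ℝ} : v ∈ intLat ι ↔ ∀ i, ∃ m : ℤ, v i = m := Iff.rfl

open Matrix in
theorem exists_int_normalizing_translation {r kp km : ℕ} {b : BIdx r kp km → ℝ}
    (hb : (sMat r kp km).map (Int.cast : ℤ → ℝ) *ᵥ b + b ∈ intLat (BIdx r kp km)) :
    ∃ (lam : BIdx r kp km → ℤ) (c : BIdx r kp km → ℝ) (x : Fin kp → ℤ),
      (∀ i, x i = 0 ∧ (∃ m : ℤ, b (.inr (.inl i)) = m) ∨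
        x i = 1 ∧ ¬ ∃ m : ℤ, b (.inr (.inl i)) = m) ∧
      b + (fun i => (lam i : ℝ)) + (sMat r kp km).map (Int.cast : ℤ → ℝ) *ᵥ c - c =
        Sum.elim (0 : Fin r ⊕ Fin r → ℝ) (Sum.elim (fun i => (x i : ℝ) / 2) 0) := by
  rw [sMat_map_mulVec, mem_intLat] at hb
  choose m hm using hb
  have hpair (i : Fin r) : b (.inl (.inl i)) + b (.inl (.inr i)) = m (.inl (.inr i)) := by
    simpa using hm (.inl (.inr i))
  have hplus (i : Fin kp) : b (.inr (.inl i)) + b (.inr (.inl i)) = m (.inr (.inl i)) := by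
    simpa using hm (.inr (.inl i))
  refine ⟨Sum.elim (Sum.elim 0 fun i => -m (.inl (.inr i)))
      (Sum.elim (fun i => -(m (.inr (.inl i)) / 2)) 0),
    Sum.elim (Sum.elim (fun i => b (.inl (.inl i))) 0)
      (Sum.elim 0 fun i => b (.inr (.inr i)) / 2),
    fun i => m (.inr (.inl i)) % 2, fun i => ?_, ?_⟩
  · have h := hplus i
    rcases Int.emod_two_eq_zero_or_one (m (.inr (.inl i))) with h0 | h1
    · refine .inl ⟨h0, m (.inr (.inl i)) / 2, ?_⟩
      have : (m (.inr (.inl i)) : ℝ) = 2 * ((m (.inr (.inl i)) / 2 : ℤ) : ℝ) := by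
        exact_mod_cast (by lia)
      linarith
    · refine .inr ⟨h1, fun ⟨k, hk⟩ => ?_⟩
      rw [hk] at h
      have : k + k = m (.inr (.inl i)) := by exact_mod_cast h
      lia
  · rw [sMat_map_mulVec]
    ext ((i | i) | (i | i))
    · simp
    · simp [← hpair]
    · have h := hplus i
      have hd : (m (.inr (.inl i)) : ℝ) =
          2 * ((m (.inr (.inl i)) / 2 : ℤ) : ℝ) + ((m (.inr (.inl i)) % 2 : ℤ) : ℝ) := by
        exact_mod_cast (Int.mul_ediv_add_emod _ _).symm
      simp only [Pi.add_apply, Pi.sub_apply, Sum.elim_inr, Sum.elim_inl, Int.cast_neg,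
        Pi.zero_apply]
      linarith
    · simp
      ring

open Matrix in
theorem fromBlocks_map_mulVec_plus (r : ℕ) {kp km : ℕ} (h : Matrix (Fin kp) (Fin kp) ℤ)
    (x : Fin kp → ℤ) :
    (fromBlocks (1 : Matrix (Fin r ⊕ Fin r) (Fin r ⊕ Fin r) ℤ) 0 0
        (fromBlocks h 0 0 (1 : Matrix (Fin km) (Fin km) ℤ))).map (Int.cast : ℤ → ℝ) *ᵥ
        Sum.elim (0 : Fin r ⊕ Fin r → ℝ) (Sum.elim (fun i => (x i : ℝ) / 2) 0) =
      Sum.elim (0 : Fin r ⊕ Fin r → ℝ) (Sum.elim (fun i => ((h *ᵥ x) i : ℝ) / 2) 0) := by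
  ext ((i | i) | (i | i)) <;>
    simp [mulVec, dotProduct, Fintype.sum_sum_type, Finset.sum_div, mul_div_assoc]

open Matrix in
theorem exists_fixed_point_iff {r kp km : ℕ} {b : BIdx r kp km → ℝ}
    {σ : TorusB r kp km → TorusB r kp km}
    (hσ : ∀ v : BIdx r kp km → ℝ, σ (QuotientAddGroup.mk v) =
      QuotientAddGroup.mk ((sMat r kp km).map (Int.cast : ℤ → ℝ) *ᵥ v + b)) :
    (∃ p, σ p = p) ↔ ∃ c : BIdx r kp km → ℝ,
      b + (sMat r kp km).map (Int.cast : ℤ → ℝ) *ᵥ c - c ∈ intLat (BIdx r kp km) := by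
  rw [(QuotientAddGroup.mk_surjective).exists]
  refine exists_congr fun c => ?_
  rw [hσ, eq_comm, QuotientAddGroup.eq]
  exact iff_of_eq (congrArg (· ∈ intLat _) (by abel))

/-- Normal form for affine involutions `x ↦ s·x + b` of the n-torus with linear part
`s(u, v, w⁺, w⁻) = (v, u, w⁺, -w⁻)`: after changing the lift by `λ ∈ ℤⁿ`, the origin by
`c ∈ ℝⁿ`, and the basis by `g ∈ GL(n,ℤ)` commuting with `s`, the translation part `b'`
becomes either `0` or `(0, 0, (1/2)e₁, 0)`; the first case occurs exactly when the
involution has a fixed point (so in the second case it is fixed-point free). -/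
theorem affine_involution_on_torus_normal_form (r kp km : ℕ)
    (b : BIdx r kp km → ℝ)
    (hb : ((sMat r kp km).map (Int.cast : ℤ → ℝ)).mulVec b + b ∈ intLat (BIdx r kp km))
    (σ : TorusB r kp km → TorusB r kp km)
    (hσ : ∀ v : BIdx r kp km → ℝ, σ (QuotientAddGroup.mk v) =
      QuotientAddGroup.mk (((sMat r kp km).map (Int.cast : ℤ → ℝ)).mulVec v + b)) :
    ∃ (lam : BIdx r kp km → ℤ) (c : BIdx r kp km → ℝ)
      (g : Matrix (BIdx r kp km) (BIdx r kp km) ℤ) (b' : BIdx r kp km → ℝ),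
      IsUnit g.det ∧
      g * sMat r kp km = sMat r kp km * g ∧
      b' = (g.map (Int.cast : ℤ → ℝ)).mulVec
        (b + (fun i => ((lam i : ℤ) : ℝ)) +
          ((sMat r kp km).map (Int.cast : ℤ → ℝ)).mulVec c - c) ∧
      (b' = 0 ∨ (1 ≤ kp ∧ b' = halfE1 r kp km)) ∧
      (b' = 0 ↔ ∃ p : TorusB r kp km, σ p = p) := by
  obtain ⟨lam, c, x, hx, hbc⟩ := exists_int_normalizing_translation hb
  rw [exists_fixed_point_iff hσ]
  by_cases hint : ∀ i, x i = 0
  · have hzero : b + (fun i => (lam i : ℝ)) +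
        ((sMat r kp km).map (Int.cast : ℤ → ℝ)).mulVec c - c = 0 := by
      rw [hbc]
      ext ((i | i) | (i | i)) <;> simp [hint]
    refine ⟨lam, c, 1, 0, by simp, by simp, by rw [hzero, Matrix.mulVec_zero], .inl rfl,
      iff_of_true rfl ⟨c, fun i => ⟨-lam i, ?_⟩⟩⟩
    have h := congrFun hzero i
    simp only [Pi.add_apply, Pi.sub_apply, Pi.zero_apply] at h ⊢
    push_cast
    linarith
  · push Not at hint
    obtain ⟨j, hj⟩ := hint
    obtain ⟨hxj, hbj⟩ := (hx j).resolve_left fun h => hj h.1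
    have hkp : 0 < kp := j.pos
    obtain ⟨h, hdet, hh⟩ := exists_isUnit_det_mulVec_eq_single x ⟨0, hkp⟩ j hxj
    refine ⟨lam, c, .fromBlocks 1 0 0 (.fromBlocks h 0 0 1), halfE1 r kp km, by simpa using hdet,
      commute_sMat_fromBlocks r kp km h, ?_, .inr ⟨hkp, rfl⟩, iff_of_false ?_ ?_⟩
    · rw [hbc, fromBlocks_map_mulVec_plus, hh]
      ext ((i | i) | (i | i)) <;> simp [halfE1, Pi.single_apply, Fin.ext_iff, ite_div]
    · intro h0
      simpa [halfE1] using congrFun h0 (.inr (.inl ⟨0, hkp⟩))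
    · rintro ⟨d, hd⟩
      apply hbj
      simpa [sMat_map_mulVec] using hd (.inr (.inl j))
end

section
/- Every matrix s ∈ GL(n, ℤ) with s² = I is conjugate in GL(n, ℤ) to a block-diagonal matrix each of whose diagonal blocks is one of: the 1×1 block (1), the 1×1 block (−1), or the 2×2 block [[0,1],[1,0]]. That is, there exists P ∈ GL(n, ℤ) such that P·s·P⁻¹ has this block-diagonal form. -/
open Module Submodule in
/-- An involution of a finite free `ℤ`-module admits generators in which it is block triangular:
fixed vectors `e i`, negated vectors `k j`, and vectors `z l` sent to `t l • e (f l) - z l`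
with `t l ∈ {0, 1}`. -/
theorem exists_triangular_generators_of_involution {M : Type*} [AddCommGroup M] [Module.Free ℤ M]
    [Module.Finite ℤ M] (s : M →ₗ[ℤ] M) (hs : ∀ x, s (s x) = x) :
    ∃ (p q r : ℕ) (e : Fin p → M) (k : Fin q → M) (z : Fin r → M) (f : Fin r ↪ Fin p)
      (t : Fin r → ℤ),
      span ℤ (Set.range e) ⊔ span ℤ (Set.range k) ⊔ span ℤ (Set.range z) = ⊤ ∧
      p + q + r = finrank ℤ M ∧ (∀ i, s (e i) = e i) ∧ (∀ j, s (k j) = -k j) ∧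
      (∀ l, s (z l) = t l • e (f l) - z l) ∧ ∀ l, t l = 0 ∨ t l = 1 := by
  let d : M →ₗ[ℤ] M := s - LinearMap.id
  have hd (x : M) : d x = s x - x := rfl
  obtain ⟨h, hh⟩ := projective_lifting_property d.rangeRestrict LinearMap.id
    d.surjective_rangeRestrict
  have hdh (y : LinearMap.range d) : d (h y) = y := congrArg Subtype.val (LinearMap.congr_fun hh y)
  let φ : LinearMap.range d →ₗ[ℤ] LinearMap.ker d :=
    ((s + LinearMap.id) ∘ₗ h).codRestrict _ fun y ↦ by simp [hd, hs, add_comm]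
  have hφ (y : LinearMap.range d) : (φ y : M) = s (h y) + h y := rfl
  obtain ⟨g, hg⟩ := projective_lifting_property φ.rangeRestrict LinearMap.id
    φ.surjective_rangeRestrict
  have hφg (y : LinearMap.range φ) : φ (g y) = y := congrArg Subtype.val (LinearMap.congr_fun hg y)
  obtain ⟨r, B⟩ := (LinearMap.range φ).smithNormalForm (finBasis ℤ (LinearMap.ker d))
  let K := finBasis ℤ (LinearMap.ker φ)
  let e (i : Fin (finrank ℤ (LinearMap.ker d))) : M := B.bM i
  let k (j : Fin (finrank ℤ (LinearMap.ker φ))) : M := h (K j)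
  let z (l : Fin r) : M := h (g (B.bN l)) - (B.a l / 2) • e (B.f l)
  have he (i) : s (e i) = e i := sub_eq_zero.mp ((hd _).symm.trans (B.bM i).2)
  refine ⟨_, _, r, e, k, z, B.f, fun l ↦ B.a l % 2, ?_, ?_, he, fun j ↦ ?_, fun l ↦ ?_,
    fun l ↦ Int.emod_two_eq_zero_or_one _⟩
  · set S := span ℤ (Set.range e) ⊔ span ℤ (Set.range k) ⊔ span ℤ (Set.range z)
    have heS (i) : e i ∈ S := mem_sup_left (mem_sup_left (subset_span ⟨i, rfl⟩))
    have hkS (j) : k j ∈ S := mem_sup_left (mem_sup_right (subset_span ⟨j, rfl⟩))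
    have hzS (l) : z l ∈ S := mem_sup_right (subset_span ⟨l, rfl⟩)
    have hker (x : LinearMap.ker d) : (x : M) ∈ S := by
      have : (⊤ : Submodule ℤ (LinearMap.ker d)) ≤ S.comap (LinearMap.ker d).subtype := by
        rw [← B.bM.span_eq, span_le]
        rintro _ ⟨i, rfl⟩
        exact heS i
      exact this (mem_top (x := x))
    have hkerφ (x : LinearMap.ker φ) : h x ∈ S := by
      have : (⊤ : Submodule ℤ (LinearMap.ker φ)) ≤
          S.comap (h ∘ₗ (LinearMap.ker φ).subtype) := by
        rw [← K.span_eq, span_le]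
        rintro _ ⟨j, rfl⟩
        exact hkS j
      exact this (mem_top (x := x))
    have hrange (x : LinearMap.range φ) : h (g x) ∈ S := by
      have : (⊤ : Submodule ℤ (LinearMap.range φ)) ≤ S.comap (h ∘ₗ g) := by
        rw [← B.bN.span_eq, span_le]
        rintro _ ⟨l, rfl⟩
        simpa [z] using S.add_mem (hzS l) (S.smul_mem (B.a l / 2) (heS (B.f l)))
      exact this (mem_top (x := x))
    rw [eq_top_iff]
    intro x _
    let y := d.rangeRestrict x
    have h₁ := hker ⟨x - h y, by simp [hdh, y]⟩
    have h₂ := hkerφ ⟨y - g (φ.rangeRestrict y), by simp [hφg]⟩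
    have h₃ := hrange (φ.rangeRestrict y)
    have := S.add_mem (S.add_mem h₁ h₂) h₃
    simpa using this
  · have h₁ := (LinearMap.ker d).finrank_quotient_add_finrank
    have h₂ := (LinearMap.ker φ).finrank_quotient_add_finrank
    have h₃ := finrank_eq_card_basis B.bN
    rw [d.quotKerEquivRange.finrank_eq] at h₁
    rw [φ.quotKerEquivRange.finrank_eq] at h₂
    rw [Fintype.card_fin] at h₃
    omega
  · have := hφ (K j)
    rw [(K j).2, ZeroMemClass.coe_zero] at this
    exact eq_neg_of_add_eq_zero_left this.symm
  · have h₁ : B.a l • e (B.f l) = s (h (g (B.bN l))) + h (g (B.bN l)) := by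
      rw [← hφ, hφg, B.snf]; rfl
    have h₂ : (B.a l % 2) • e (B.f l) = B.a l • e (B.f l) - (2 * (B.a l / 2)) • e (B.f l) := by
      rw [← sub_smul, Int.emod_def]
    simp only [z, map_sub, map_smul, he]
    rw [h₂, h₁]
    module

open Module Submodule in
/-- Every involution of a finite free `ℤ`-module has a basis of fixed vectors, negated vectors and
swapped pairs. -/
theorem exists_basis_of_involution {M : Type*} [AddCommGroup M] [Module.Free ℤ M]
    [Module.Finite ℤ M] (s : M →ₗ[ℤ] M) (hs : ∀ x, s (s x) = x) :
    ∃ (a b c : ℕ) (w : Basis (Fin a ⊕ (Fin b ⊕ (Fin c ⊕ Fin c))) ℤ M),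
      (∀ i, s (w (.inl i)) = w (.inl i)) ∧
      (∀ i, s (w (.inr (.inl i))) = -w (.inr (.inl i))) ∧
      (∀ i, s (w (.inr (.inr (.inl i)))) = w (.inr (.inr (.inr i)))) ∧
      ∀ i, s (w (.inr (.inr (.inr i)))) = w (.inr (.inr (.inl i))) := by
  classical
  obtain ⟨p, q, r, e, k, z, f, t, hspan, hrank, he, hk, hz, ht⟩ :=
    exists_triangular_generators_of_involution s hs
  let C := {l : Fin r // t l = 1}
  let A := {i : Fin p // ¬ ∃ l : C, f l = i}
  let B := Fin q ⊕ {l : Fin r // ¬ t l = 1}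
  let v : A ⊕ (B ⊕ (C ⊕ C)) → M :=
    Sum.elim (fun i ↦ e i) (Sum.elim (Sum.elim k fun l ↦ z l)
      (Sum.elim (fun l ↦ z l) fun l ↦ s (z l)))
  have hsp : ⊤ ≤ span ℤ (Set.range v) := by
    have hv (x) : v x ∈ span ℤ (Set.range v) := subset_span ⟨x, rfl⟩
    have hzv (l) : z l ∈ span ℤ (Set.range v) := by
      by_cases hl : t l = 1
      · exact hv (.inr (.inr (.inl ⟨l, hl⟩)))
      · exact hv (.inr (.inl (.inr ⟨l, hl⟩)))
    rw [← hspan]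
    refine sup_le (sup_le ?_ ?_) ?_ <;> rw [span_le] <;> rintro _ ⟨i, rfl⟩
    · by_cases hi : ∃ l : C, f l = i
      · obtain ⟨l, rfl⟩ := hi
        have := add_mem (hv (.inr (.inr (.inr l)))) (hzv l)
        simpa [v, hz, l.2] using this
      · exact hv (.inl ⟨i, hi⟩)
    · exact hv (.inr (.inl (.inl i)))
    · exact hzv i
  have hcard : Fintype.card (A ⊕ (B ⊕ (C ⊕ C))) = finrank ℤ M := by
    have h₁ : Fintype.card {i : Fin p // ∃ l : C, f l = i} = Fintype.card C :=
      Fintype.card_congr (Equiv.ofInjective (fun l : C ↦ f l)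
        (f.injective.comp Subtype.val_injective)).symm
    have h₂ := Fintype.card_subtype_compl (fun i : Fin p ↦ ∃ l : C, f l = i)
    have h₃ := Fintype.card_subtype_le (fun i : Fin p ↦ ∃ l : C, f l = i)
    have h₄ := Fintype.card_subtype_compl (fun l : Fin r ↦ t l = 1)
    have h₅ := Fintype.card_subtype_le (fun l : Fin r ↦ t l = 1)
    simp only [Fintype.card_sum, Fintype.card_fin, A, B, C] at *
    omega
  let w := basisOfTopLeSpanOfCardEqFinrank v hsp hcard
  let E := Fintype.equivFin A |>.sumCongr
    (Fintype.equivFin B |>.sumCongr (Fintype.equivFin C |>.sumCongr (Fintype.equivFin C)))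
  have hw (x) : w.reindex E x = v (E.symm x) := by simp [w]
  refine ⟨_, _, _, w.reindex E, fun i ↦ ?_, fun i ↦ ?_, fun i ↦ ?_, fun i ↦ ?_⟩ <;>
    simp only [hw, E, Equiv.sumCongr_symm, Equiv.sumCongr_apply, Sum.map_inl, Sum.map_inr, v,
      Sum.elim_inl, Sum.elim_inr, he, hs]
  generalize (Fintype.equivFin B).symm i = j
  obtain j | ⟨l, hl⟩ := j
  · exact hk j
  · simp [hz, (ht l).resolve_right hl]


/-- Every integral involution is conjugate in `GL(n,ℤ)` to a block-diagonal matrix with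
diagonal blocks `(1)`, `(-1)` and `[[0,1],[1,0]]`: there are `a` blocks `(1)`, `b`
blocks `(-1)` and `c` swap blocks (here assembled, after reindexing `Fin n` by
`Fin a ⊕ (Fin b ⊕ (Fin c ⊕ Fin c))`, into `diag(I_a, -I_b, [[0,I_c],[I_c,0]])`). -/
theorem integral_involution_normal_form (n : ℕ)
    (s : Matrix (Fin n) (Fin n) ℤ) (hdet : IsUnit s.det) (hs : s * s = 1) :
    ∃ (a b c : ℕ) (e : Fin n ≃ (Fin a ⊕ (Fin b ⊕ (Fin c ⊕ Fin c))))
      (P : Matrix (Fin n) (Fin n) ℤ),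
      IsUnit P.det ∧
      P * s * P⁻¹ =
        Matrix.reindex e.symm e.symm
          (Matrix.fromBlocks 1 0 0
            (Matrix.fromBlocks (-1) 0 0 (Matrix.fromBlocks 0 1 1 0))) := by
  have hinv : ∀ x, Matrix.toLin' s (Matrix.toLin' s x) = x := fun x ↦ by
    rw [← Matrix.toLin'_mul_apply, hs, Matrix.toLin'_one, LinearMap.id_apply]
  obtain ⟨a, b, c, w, h₁, h₂, h₃, h₄⟩ := exists_basis_of_involution (Matrix.toLin' s) hinv
  let e := (Pi.basisFun ℤ (Fin n)).indexEquiv w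
  let w' := w.reindex e.symm
  let Q := (Pi.basisFun ℤ (Fin n)).toMatrix w'
  let P := w'.toMatrix (Pi.basisFun ℤ (Fin n))
  have hPQ : P * Q = 1 := w'.toMatrix_mul_toMatrix_flip _
  refine ⟨a, b, c, e, P, Matrix.isUnit_det_of_right_inverse hPQ, ?_⟩
  rw [Matrix.inv_eq_right_inv hPQ]
  have hconj := basis_toMatrix_mul_linearMap_toMatrix_mul_basis_toMatrix w' (Pi.basisFun ℤ (Fin n))
    w' (Pi.basisFun ℤ (Fin n)) (Matrix.toLin' s)
  rw [← Matrix.toLin_eq_toLin', LinearMap.toMatrix_toLin] at hconj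
  rw [hconj, Matrix.toLin_eq_toLin']
  ext i j
  have hrepr (x : Fin n → ℤ) : w'.repr x i = w.repr x (e i) := by simp [w']
  have hw' : w' j = w (e j) := by simp [w']
  rw [LinearMap.toMatrix_apply, hrepr, hw', Matrix.reindex_apply, Matrix.submatrix_apply,
    Equiv.symm_symm]
  generalize e i = x
  generalize e j = y
  rcases y with y | y | y | y <;> rcases x with x | x | x | x <;>
    simp [h₁, h₂, h₃, h₄, Finsupp.single_apply, Matrix.one_apply, eq_comm]
end

section
/- Let s = diag(I_n, −I_n) ∈ M_{2n}(ℝ) be the block-diagonal matrix with blocks the identity I_n and −I_n. A matrix J ∈ M_{2n}(ℝ) satisfies J² = −I and J·s = −s·J if and only if J has the block form [[0, A],[−A⁻¹, 0]] for some A ∈ GL(n, ℝ). Moreover, the set of all such J, as a subspace of M_{2n}(ℝ), has exactly two connected components, distinguished by the sign of det A. -/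
/-- The involution `s = diag(I_n, -I_n)` of `ℝ^{2n}`, in block form. -/
def sDiag (n : ℕ) : Matrix (Fin n ⊕ Fin n) (Fin n ⊕ Fin n) ℝ :=
  Matrix.fromBlocks 1 0 0 (-1)

/-- The set of complex structures `J` on `ℝ^{2n}` anticommuting with `diag(I_n, -I_n)`. -/
def cxStructuresDiag (n : ℕ) : Set (Matrix (Fin n ⊕ Fin n) (Fin n ⊕ Fin n) ℝ) :=
  {J | J * J = -1 ∧ J * sDiag n = -(sDiag n * J)}

open Matrix in
/-- The real invertible matrices in the identity component of `GL`, as a submonoid of the ring of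
matrices. -/
noncomputable def identityComponentGL (ι : Type*) [Fintype ι] [DecidableEq ι] :
    Submonoid (Matrix ι ι ℝ) :=
  (Subgroup.connectedComponentOfOne (GL ι ℝ)).toSubmonoid.map (Units.coeHom (Matrix ι ι ℝ))

namespace identityComponentGL

open Matrix

variable {ι : Type*} [Fintype ι] [DecidableEq ι]

theorem mem_of_continuous {X : Type*} [TopologicalSpace X] [PreconnectedSpace X]
    {f g : X → Matrix ι ι ℝ} (hf : Continuous f) (hg : Continuous g)
    (hfg : ∀ x, f x * g x = 1) {x₀ : X} (h₀ : f x₀ = 1) (x : X) :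
    f x ∈ identityComponentGL ι := by
  let u : X → GL ι ℝ := fun x => ⟨f x, g x, hfg x, mul_eq_one_comm.mp (hfg x)⟩
  have hu : Continuous u := Units.continuous_iff.mpr ⟨hf, hg⟩
  refine ⟨u x, ?_, rfl⟩
  have h1 : u x₀ = 1 := Units.ext h₀
  have : Set.range u ⊆ connectedComponent (1 : GL ι ℝ) :=
    (isPreconnected_range hu).subset_connectedComponent ⟨x₀, h1⟩
  exact this ⟨x, rfl⟩

theorem transvection_mem {i j : ι} (h : i ≠ j) (c : ℝ) :
    transvection i j c ∈ identityComponentGL ι := by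
  have hc : Continuous fun t : ℝ => transvection i j t := by
    unfold transvection
    refine continuous_const.add (continuous_matrix fun a b => ?_)
    simp only [single_apply]
    split_ifs <;> fun_prop
  refine mem_of_continuous (f := fun t : ℝ => transvection i j t) hc
    (hc.comp continuous_neg) (fun t => ?_) (x₀ := 0) (transvection_zero i j) c
  simp [transvection_mul_transvection_same _ _ h]

theorem diagonal_mem_of_pos {d : ι → ℝ} (hd : ∀ i, 0 < d i) :
    diagonal d ∈ identityComponentGL ι := by
  have hc : Continuous fun v : ι → ℝ => diagonal fun i => Real.exp (v i) := by fun_prop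
  have := mem_of_continuous (f := fun v : ι → ℝ => diagonal fun i => Real.exp (v i)) hc
    (hc.comp continuous_neg) (fun v => by simp [← Real.exp_add]) (x₀ := 0) (by simp)
    fun i => Real.log (d i)
  simpa only [Real.exp_log (hd _)] using this

/-- The diagonal matrix with entries `-1` at two places is the square of a product of three
transvections. -/
theorem diagonal_neg_neg_mem {i j : ι} (h : i ≠ j) :
    diagonal (fun k => if k = i ∨ k = j then (-1 : ℝ) else 1) ∈ identityComponentGL ι := by
  have hw : transvection i j (1 : ℝ) * transvection j i (-1) * transvection i j 1 ∈
      identityComponentGL ι :=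
    mul_mem (mul_mem (transvection_mem h _) (transvection_mem h.symm _)) (transvection_mem h _)
  convert mul_mem hw hw using 1
  have e : transvection i j (1 : ℝ) * transvection j i (-1) * transvection i j 1 =
      1 - single i i 1 - single j j 1 + single i j 1 - single j i 1 := by
    simp only [transvection, mul_add, add_mul, mul_one, one_mul, single_mul_single_same,
      single_mul_single_of_ne _ _ _ _ h.symm, mul_neg,
      ← single_neg, neg_mul]
    abel
  have e' : diagonal (fun k => if k = i ∨ k = j then (-1 : ℝ) else 1) =
      1 - single i i 1 - single j j 1 - single i i 1 - single j j 1 := by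
    ext a b
    simp only [diagonal_apply, Matrix.sub_apply, one_apply, single_apply]
    grind
  rw [e, e']
  simp only [mul_add, add_mul, mul_sub, sub_mul, mul_one, one_mul, single_mul_single_same,
    single_mul_single_of_ne _ _ _ _ h, single_mul_single_of_ne _ _ _ _ h.symm]
  abel

theorem diagonal_mem {d : ι → ℝ} (hd : 0 < ∏ i, d i) : diagonal d ∈ identityComponentGL ι := by
  induction hn : (Finset.univ.filter fun i => d i < 0).card using Nat.strong_induction_on
    generalizing d with
  | _ n ih =>
    subst hn
    have hd0 : ∀ i, d i ≠ 0 := fun i => Finset.prod_ne_zero_iff.mp hd.ne' i (Finset.mem_univ i)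
    by_cases hpos : ∀ i, 0 < d i
    · exact diagonal_mem_of_pos hpos
    push Not at hpos
    obtain ⟨i, hi⟩ := hpos
    have hi : d i < 0 := lt_of_le_of_ne hi (hd0 i)
    obtain ⟨j, hji, hj⟩ : ∃ j, j ≠ i ∧ d j < 0 := by
      by_contra! hcon
      rw [← Finset.mul_prod_erase _ _ (Finset.mem_univ i)] at hd
      have : 0 ≤ ∏ x ∈ Finset.univ.erase i, d x :=
        Finset.prod_nonneg fun x hx => hcon x (Finset.ne_of_mem_erase hx)
      nlinarith
    let ε : ι → ℝ := fun k => if k = i ∨ k = j then -1 else 1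
    have hε : ∏ k, ε k = 1 := by
      have : ∀ k, ε k = (if k = i then -1 else 1) * (if k = j then -1 else 1) := by
        intro k
        simp only [ε]
        grind
      rw [Finset.prod_congr rfl fun k _ => this k, Finset.prod_mul_distrib]
      simp
    have hεε : ∀ k, ε k * ε k = 1 := by
      intro k
      simp only [ε]
      split_ifs <;> norm_num
    have hmem : diagonal (fun k => d k * ε k) ∈ identityComponentGL ι := by
      refine ih _ (Finset.card_lt_card ?_) (by rwa [Finset.prod_mul_distrib, hε, mul_one]) rfl
      refine Finset.ssubset_iff_subset_ne.mpr ⟨fun k hk => ?_, fun heq => ?_⟩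
      · simp only [Finset.mem_filter, Finset.mem_univ, true_and, ε] at hk ⊢
        split_ifs at hk with hkij
        · rcases hkij with rfl | rfl <;> assumption
        · simpa using hk
      · have : i ∈ Finset.univ.filter fun k => d k * ε k < 0 := by
          rw [heq]
          simpa using hi
        simp [ε] at this
        linarith
    convert mul_mem hmem (diagonal_neg_neg_mem hji.symm) using 1
    rw [diagonal_mul_diagonal]
    congr 1
    ext k
    have := hεε k
    simp only [ε] at this ⊢
    rw [mul_assoc, this, mul_one]

theorem mem_of_det_pos {M : Matrix ι ι ℝ} (hM : 0 < M.det) : M ∈ identityComponentGL ι := by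
  obtain ⟨L, L', d, rfl⟩ := Pivot.exists_list_transvec_mul_diagonal_mul_list_transvec M
  have hL : ∀ L : List (TransvectionStruct ι ℝ),
      (L.map TransvectionStruct.toMatrix).prod ∈ identityComponentGL ι := by
    refine fun L => Submonoid.list_prod_mem _ fun x hx => ?_
    obtain ⟨t, -, rfl⟩ := List.mem_map.mp hx
    exact transvection_mem t.hij t.c
  refine mul_mem (mul_mem (hL L) (diagonal_mem ?_)) (hL L')
  simpa using hM

end identityComponentGL

theorem mem_connectedComponent_GL_of_det_mul_pos {ι : Type*} [Fintype ι] [DecidableEq ι]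
    {A B : Matrix.GeneralLinearGroup ι ℝ} (h : 0 < A.val.det * B.val.det) :
    B ∈ connectedComponent A := by
  have hAB : 0 < (B * A⁻¹).val.det := by
    have hA : A.val.det * (A⁻¹).val.det = 1 := by
      rw [← Matrix.det_mul, ← Units.val_mul, mul_inv_cancel, Units.val_one, Matrix.det_one]
    rw [Units.val_mul, Matrix.det_mul]
    have h2 : 0 < (A⁻¹).val.det ^ 2 := by
      have : (A⁻¹).val.det ≠ 0 := right_ne_zero_of_mul_eq_one hA
      positivity
    calc 0 < A.val.det * B.val.det * (A⁻¹).val.det ^ 2 := mul_pos h h2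
      _ = B.val.det * (A⁻¹).val.det * (A.val.det * (A⁻¹).val.det) := by ring
      _ = _ := by rw [hA, mul_one]
  obtain ⟨g, hg, hgv⟩ := identityComponentGL.mem_of_det_pos hAB
  obtain rfl : g = B * A⁻¹ := Units.ext hgv
  have := (continuous_mul_const A).image_connectedComponent_subset
    (1 : Matrix.GeneralLinearGroup ι ℝ) ⟨_, hg, rfl⟩
  simpa using this

theorem mem_cxStructuresDiag_iff {n : ℕ} (J : Matrix (Fin n ⊕ Fin n) (Fin n ⊕ Fin n) ℝ) :
    J ∈ cxStructuresDiag n ↔ ∃ A : Matrix (Fin n) (Fin n) ℝ, IsUnit A.det ∧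
      J = Matrix.fromBlocks 0 A (-A⁻¹) 0 := by
  constructor
  · rintro ⟨hJ, hs⟩
    rw [← Matrix.fromBlocks_toBlocks J] at hJ hs ⊢
    generalize J.toBlocks₁₁ = P at *
    generalize J.toBlocks₁₂ = A at *
    generalize J.toBlocks₂₁ = C at *
    generalize J.toBlocks₂₂ = Q at *
    simp only [sDiag, Matrix.fromBlocks_multiply, Matrix.fromBlocks_neg, Matrix.fromBlocks_inj,
      mul_one, one_mul, mul_zero, zero_mul, add_zero, zero_add, mul_neg, neg_mul, neg_neg] at hs
    obtain ⟨hP, -, -, hQ⟩ := hs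
    have eq_zero_of_eq_neg : ∀ M : Matrix (Fin n) (Fin n) ℝ, M = -M → M = 0 := fun M hM => by
      ext a b
      exact self_eq_neg.mp (congrFun₂ hM a b)
    obtain rfl := eq_zero_of_eq_neg P hP
    obtain rfl := eq_zero_of_eq_neg Q hQ.symm
    rw [← Matrix.fromBlocks_one, Matrix.fromBlocks_multiply, Matrix.fromBlocks_neg,
      Matrix.fromBlocks_inj] at hJ
    have hAC : A * -C = 1 := by
      have := hJ.1
      rw [zero_mul, zero_add] at this
      rw [mul_neg, this, neg_neg]
    refine ⟨A, Matrix.isUnit_det_of_right_inverse hAC, ?_⟩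
    rw [Matrix.inv_eq_right_inv hAC, neg_neg]
  · rintro ⟨A, hA, rfl⟩
    refine ⟨?_, ?_⟩
    · rw [← Matrix.fromBlocks_one, Matrix.fromBlocks_neg]
      simp [Matrix.fromBlocks_multiply, Matrix.mul_nonsing_inv _ hA, Matrix.nonsing_inv_mul _ hA]
    · simp [sDiag, Matrix.fromBlocks_multiply, Matrix.fromBlocks_neg]

theorem isUnit_det_of_fromBlocks_mem {n : ℕ} {A C : Matrix (Fin n) (Fin n) ℝ}
    (h : Matrix.fromBlocks 0 A C 0 ∈ cxStructuresDiag n) : IsUnit A.det := by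
  obtain ⟨B, hB, hAB⟩ := (mem_cxStructuresDiag_iff _).mp h
  rwa [(Matrix.fromBlocks_inj.mp hAB).2.1]

/-- The complex structure with upper right block a given invertible matrix. -/
noncomputable def cxStructureOfGL {n : ℕ} (A : Matrix.GeneralLinearGroup (Fin n) ℝ) :
    cxStructuresDiag n :=
  ⟨Matrix.fromBlocks 0 A (-A.val⁻¹) 0, (mem_cxStructuresDiag_iff _).mpr
    ⟨A, (Matrix.isUnit_iff_isUnit_det _).mp A.isUnit, rfl⟩⟩

theorem continuous_cxStructureOfGL (n : ℕ) : Continuous (cxStructureOfGL (n := n)) := by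
  refine Continuous.subtype_mk ?_ _
  simp only [← Matrix.coe_units_inv]
  exact continuous_const.matrix_fromBlocks Units.continuous_val
    (Units.continuous_val.comp continuous_inv).neg continuous_const

theorem isClopen_setOf_det_toBlocks₁₂_pos (n : ℕ) :
    IsClopen {J : cxStructuresDiag n | 0 < J.val.toBlocks₁₂.det} := by
  have hc : Continuous fun J : cxStructuresDiag n => J.val.toBlocks₁₂.det := by
    refine Continuous.matrix_det (continuous_matrix fun i j => ?_)
    exact (continuous_subtype_val.matrix_elem (Sum.inl i) (Sum.inr j))
  refine ⟨?_, isOpen_lt continuous_const hc⟩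
  have : {J : cxStructuresDiag n | 0 < J.val.toBlocks₁₂.det} =
      {J : cxStructuresDiag n | 0 ≤ J.val.toBlocks₁₂.det} := by
    ext ⟨J, hJ⟩
    obtain ⟨A, hA, rfl⟩ := (mem_cxStructuresDiag_iff _).mp hJ
    simp only [Set.mem_ofPred_eq, Matrix.toBlocks_fromBlocks₁₂]
    exact ⟨le_of_lt, fun h => lt_of_le_of_ne h hA.ne_zero.symm⟩
  rw [this]
  exact isClosed_le continuous_const hc

theorem connectedComponents_mk_eq_iff_det_pos {n : ℕ} (A A' : Matrix (Fin n) (Fin n) ℝ)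
    (hA : Matrix.fromBlocks 0 A (-A⁻¹) 0 ∈ cxStructuresDiag n)
    (hA' : Matrix.fromBlocks 0 A' (-A'⁻¹) 0 ∈ cxStructuresDiag n) :
    ConnectedComponents.mk (⟨_, hA⟩ : cxStructuresDiag n) =
      ConnectedComponents.mk (⟨_, hA'⟩ : cxStructuresDiag n) ↔ (0 < A.det ↔ 0 < A'.det) := by
  have hu := isUnit_det_of_fromBlocks_mem hA
  have hu' := isUnit_det_of_fromBlocks_mem hA'
  rw [ConnectedComponents.coe_eq_coe]
  constructor
  · intro h
    have key : ∀ {J J' : cxStructuresDiag n}, connectedComponent J = connectedComponent J' →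
        0 < J.val.toBlocks₁₂.det → 0 < J'.val.toBlocks₁₂.det := fun {J J'} h hJ =>
      (isClopen_setOf_det_toBlocks₁₂_pos n).connectedComponent_subset hJ
        (h ▸ mem_connectedComponent)
    constructor
    · simpa using key h
    · simpa using key h.symm
  · intro h
    have hpos : 0 < A.det * A'.det := by
      by_cases h0 : 0 < A.det
      · exact mul_pos h0 (h.mp h0)
      · exact mul_pos_of_neg_of_neg (lt_of_le_of_ne (not_lt.mp h0) hu.ne_zero)
          (lt_of_le_of_ne (not_lt.mp (h0 ∘ h.mpr)) hu'.ne_zero)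
    let B := Matrix.GeneralLinearGroup.mk'' A hu
    let B' := Matrix.GeneralLinearGroup.mk'' A' hu'
    have hBB' : B' ∈ connectedComponent B := mem_connectedComponent_GL_of_det_mul_pos hpos
    exact connectedComponent_eq ((continuous_cxStructureOfGL n).image_connectedComponent_subset B
      ⟨B', hBB', rfl⟩)

/-- A matrix `J ∈ M_{2n}(ℝ)` satisfies `J² = -I` and `Js = -sJ` for
`s = diag(I_n, -I_n)` iff `J = [[0, A], [-A⁻¹, 0]]` for some `A ∈ GL(n,ℝ)`.  Moreover
the set of such `J` has exactly two connected components, distinguished by the sign of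
`det A`. -/
theorem complex_structures_anticommuting_with_diag_involution (n : ℕ) (hn : 0 < n) :
    (∀ J : Matrix (Fin n ⊕ Fin n) (Fin n ⊕ Fin n) ℝ,
      J ∈ cxStructuresDiag n ↔
        ∃ A : Matrix (Fin n) (Fin n) ℝ, IsUnit A.det ∧
          J = Matrix.fromBlocks 0 A (-A⁻¹) 0) ∧
    Nat.card (ConnectedComponents ↥(cxStructuresDiag n)) = 2 ∧
    ∀ (A A' : Matrix (Fin n) (Fin n) ℝ)
      (hA : Matrix.fromBlocks 0 A (-A⁻¹) 0 ∈ cxStructuresDiag n)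
      (hA' : Matrix.fromBlocks 0 A' (-A'⁻¹) 0 ∈ cxStructuresDiag n),
      (ConnectedComponents.mk (⟨_, hA⟩ : cxStructuresDiag n) =
        ConnectedComponents.mk (⟨_, hA'⟩ : cxStructuresDiag n) ↔
          (0 < A.det ↔ 0 < A'.det)) := by
  refine ⟨mem_cxStructuresDiag_iff, ?_, connectedComponents_mk_eq_iff_det_pos⟩
  obtain ⟨F, hF⟩ : ∃ F : Matrix (Fin n) (Fin n) ℝ, F.det = -1 :=
    ⟨Matrix.diagonal fun k => if k = ⟨0, hn⟩ then -1 else 1, by simp⟩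
  have h1 : Matrix.fromBlocks 0 1 (-1⁻¹) 0 ∈ cxStructuresDiag n :=
    (mem_cxStructuresDiag_iff _).mpr ⟨1, by simp, rfl⟩
  have h2 : Matrix.fromBlocks 0 F (-F⁻¹) 0 ∈ cxStructuresDiag n :=
    (mem_cxStructuresDiag_iff _).mpr ⟨F, by simp [hF], rfl⟩
  rw [Nat.card_eq_two_iff]
  refine ⟨ConnectedComponents.mk ⟨_, h1⟩, ConnectedComponents.mk ⟨_, h2⟩, ?_, ?_⟩
  · rw [Ne, connectedComponents_mk_eq_iff_det_pos, hF, Matrix.det_one]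
    norm_num
  · refine Set.eq_univ_of_forall fun x => ?_
    obtain ⟨⟨J, hJ⟩, rfl⟩ := ConnectedComponents.surjective_coe x
    obtain ⟨A, hA, rfl⟩ := (mem_cxStructuresDiag_iff _).mp hJ
    rw [Set.mem_insert_iff, Set.mem_singleton_iff, connectedComponents_mk_eq_iff_det_pos,
      connectedComponents_mk_eq_iff_det_pos, hF, Matrix.det_one]
    by_cases h : 0 < A.det <;> norm_num [h]
end

section
/- Let (s₁, s₂) ∈ ℂ² with (s₁, s₂) ≠ (0, 0). Then the four vectors (s₁, s₂), (i·s₁, −i·s₂), (−s₂, s₁), (i·s₂, i·s₁) are linearly independent over ℝ in ℂ² regarded as a 4-dimensional real vector space. -/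
/-- For `(s₁, s₂) ≠ (0, 0)` in `ℂ²`, the four vectors `(s₁, s₂)`, `(is₁, -is₂)`,
`(-s₂, s₁)`, `(is₂, is₁)` are ℝ-linearly independent in `ℂ²` viewed as a
4-dimensional real vector space. -/
theorem quaternionic_sections_real_linearly_independent (s₁ s₂ : ℂ)
    (h : (s₁, s₂) ≠ (0, 0)) :
    LinearIndependent ℝ
      ![((s₁, s₂) : ℂ × ℂ),
        ((Complex.I * s₁, -(Complex.I * s₂)) : ℂ × ℂ),
        ((-s₂, s₁) : ℂ × ℂ),
        ((Complex.I * s₂, Complex.I * s₁) : ℂ × ℂ)] := by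
  rw [Fintype.linearIndependent_iff]
  intro g hg
  simp only [Fin.sum_univ_four, Matrix.cons_val, Prod.smul_mk, Prod.mk_add_mk, Complex.real_smul,
    Prod.mk_eq_zero] at hg
  obtain ⟨h₁, h₂⟩ := hg
  -- The determinant of the resulting complex system in `(s₁, s₂)` is the sum of squares of `g`.
  have hs₁ : ((g 0 ^ 2 + g 1 ^ 2 + g 2 ^ 2 + g 3 ^ 2 : ℝ) : ℂ) * s₁ = 0 := by
    push_cast
    linear_combination (g 0 - Complex.I * g 1) * h₁ - (-g 2 + Complex.I * g 3) * h₂ +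
      (g 1 ^ 2 + g 3 ^ 2) * s₁ * Complex.I_sq
  have hs₂ : ((g 0 ^ 2 + g 1 ^ 2 + g 2 ^ 2 + g 3 ^ 2 : ℝ) : ℂ) * s₂ = 0 := by
    push_cast
    linear_combination (g 0 + Complex.I * g 1) * h₂ - (g 2 + Complex.I * g 3) * h₁ +
      (g 1 ^ 2 + g 3 ^ 2) * s₂ * Complex.I_sq
  have hsum : g 0 ^ 2 + g 1 ^ 2 + g 2 ^ 2 + g 3 ^ 2 = 0 := by
    by_contra hne
    have hne' := Complex.ofReal_ne_zero.mpr hne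
    exact h (Prod.ext ((mul_eq_zero.mp hs₁).resolve_left hne')
      ((mul_eq_zero.mp hs₂).resolve_left hne'))
  intro i
  refine pow_eq_zero_iff two_ne_zero |>.mp (le_antisymm ?_ (sq_nonneg _))
  rw [← hsum, ← Fin.sum_univ_four fun j => g j ^ 2]
  exact Finset.single_le_sum (f := fun j => g j ^ 2) (fun j _ => sq_nonneg (g j))
    (Finset.mem_univ i)
end

section
/- Let r ≥ 3 and m ≥ 4 be integers and p = r^m − 1, and let G be the semidirect product G = ⟨a, c | a^m = 1, c^p = 1, a·c·a⁻¹ = c^r⟩ ≅ ℤ/p ⋊ ℤ/m. Set b := a⁻¹·c⁻¹ (so that a·b·c = 1). Then the orders of a, b, c in G are exactly m, (r − 1)·m, and p = r^m − 1 respectively, and these three integers are pairwise distinct: m < (r − 1)·m < r^m − 1. -/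
/-- The relations of the presentation `⟨a, c | a^m = 1, c^p = 1, a·c·a⁻¹ = c^r⟩`
(with `a = of true` and `c = of false`), presenting the semidirect product
`ℤ/p ⋊ ℤ/m` where `a` acts on `c` by `c ↦ c^r`. -/
def triangleRels (r m p : ℕ) : Set (FreeGroup Bool) :=
  {FreeGroup.of true ^ m, FreeGroup.of false ^ p,
    FreeGroup.of true * FreeGroup.of false * (FreeGroup.of true)⁻¹ *
      (FreeGroup.of false ^ r)⁻¹}

theorem mul_pow_eq_pow_geom_sum_mul_pow {G : Type*} [Group G] {a c : G} {r : ℕ}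
    (h : a * c * a⁻¹ = c ^ r) (n : ℕ) :
    (c * a) ^ n = c ^ (∑ i ∈ Finset.range n, r ^ i) * a ^ n := by
  induction n with
  | zero => simp
  | succ n ih =>
    have conj (k : ℕ) : a * c ^ k = c ^ (r * k) * a := by
      rw [pow_mul, ← h, conj_pow, inv_mul_cancel_right]
    rw [pow_succ', ih, geom_sum_succ, pow_succ', pow_succ' a, mul_assoc, ← mul_assoc a, conj]
    simp only [mul_assoc]

section TriangleGroup

variable (r m p : ℕ)

theorem triangleRels_of_true_pow :
    PresentedGroup.of (rels := triangleRels r m p) true ^ m = 1 :=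
  PresentedGroup.one_of_mem (rels := triangleRels r m p)
    (x := FreeGroup.of true ^ m) (by simp [triangleRels])

theorem triangleRels_of_false_pow :
    PresentedGroup.of (rels := triangleRels r m p) false ^ p = 1 :=
  PresentedGroup.one_of_mem (rels := triangleRels r m p)
    (x := FreeGroup.of false ^ p) (by simp [triangleRels])

theorem triangleRels_conj :
    PresentedGroup.of (rels := triangleRels r m p) true * PresentedGroup.of false *
      (PresentedGroup.of true)⁻¹ = PresentedGroup.of false ^ r :=
  mul_inv_eq_one.mp <| PresentedGroup.one_of_mem (rels := triangleRels r m p)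
    (x := FreeGroup.of true * FreeGroup.of false * (FreeGroup.of true)⁻¹ *
      (FreeGroup.of false ^ r)⁻¹) (by simp [triangleRels])

variable {r m p}

theorem exists_triangleGroup_hom {H : Type*} [Group H] {x y : H} (hx : x ^ m = 1)
    (hy : y ^ p = 1) (hxy : x * y * x⁻¹ = y ^ r) :
    ∃ f : PresentedGroup (triangleRels r m p) →* H,
      f (PresentedGroup.of true) = x ∧ f (PresentedGroup.of false) = y := by
  have h : ∀ w ∈ triangleRels r m p, FreeGroup.lift (fun b => bif b then x else y) w = 1 := by
    rintro w (rfl | rfl | rfl) <;> simp [hx, hy, hxy]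
  exact ⟨PresentedGroup.toGroup h, by simp, by simp⟩

/-- The projection onto the complement `ℤ/m`. -/
theorem exists_triangleGroup_hom_zmod :
    ∃ f : PresentedGroup (triangleRels r m p) →* Multiplicative (ZMod m),
      f (PresentedGroup.of true) = Multiplicative.ofAdd 1 ∧ f (PresentedGroup.of false) = 1 :=
  exists_triangleGroup_hom (by rw [← ofAdd_nsmul]; simp) (by simp) (by simp)

theorem orderOf_ofAdd_one_zmod (n : ℕ) :
    orderOf (Multiplicative.ofAdd (1 : ZMod n)) = n := by
  rw [orderOf_ofAdd_eq_addOrderOf, ZMod.addOrderOf_one]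

theorem orderOf_triangleGroup_of_true :
    orderOf (PresentedGroup.of (rels := triangleRels r m p) true) = m := by
  refine Nat.dvd_antisymm (orderOf_dvd_of_pow_eq_one (triangleRels_of_true_pow r m p)) ?_
  obtain ⟨f, hf, -⟩ := exists_triangleGroup_hom_zmod (r := r) (m := m) (p := p)
  have h := orderOf_map_dvd f (PresentedGroup.of true)
  rwa [hf, orderOf_ofAdd_one_zmod] at h

/-- The order of `c` is detected by the action on `ℤ/p` in which `c` is the translation by `1` and
`a` the multiplication by `r`. -/
theorem orderOf_triangleGroup_of_false (hm : m ≠ 0) (hr : (r : ZMod p) ^ m = 1) :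
    orderOf (PresentedGroup.of (rels := triangleRels r m p) false) = p := by
  refine Nat.dvd_antisymm (orderOf_dvd_of_pow_eq_one (triangleRels_of_false_pow r m p)) ?_
  let u : (ZMod p)ˣ := Units.ofPowEqOne (r : ZMod p) m hr hm
  let x : Equiv.Perm (ZMod p) := MulAction.toPermHom _ _ u
  let y : Equiv.Perm (ZMod p) := Equiv.addRight 1
  have hu : u ^ m = 1 := Units.pow_ofPowEqOne hr hm
  have hy (n : ℕ) (z : ZMod p) : (y ^ n) z = z + n := by simp [y]
  obtain ⟨f, -, hf⟩ := exists_triangleGroup_hom (r := r) (m := m) (p := p) (x := x) (y := y)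
    (by rw [← map_pow, hu, map_one]) (by ext z; simp [hy]) (by
      rw [mul_inv_eq_iff_eq_mul]
      ext z
      simp only [Equiv.Perm.mul_apply, hy]
      simp [x, y, u, Units.smul_def])
  have h := congrArg f (pow_orderOf_eq_one (PresentedGroup.of (rels := triangleRels r m p) false))
  rw [map_pow, hf, map_one] at h
  simpa [hy, ZMod.natCast_eq_zero_iff] using DFunLike.congr_fun h 0

theorem orderOf_triangleGroup_mul {q : ℕ}
    (hc : orderOf (PresentedGroup.of (rels := triangleRels r m p) false) = p)
    (hp : p = q * ∑ i ∈ Finset.range m, r ^ i) (hS : 0 < ∑ i ∈ Finset.range m, r ^ i) :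
    orderOf (PresentedGroup.of (rels := triangleRels r m p) false * PresentedGroup.of true) =
      q * m := by
  have hpow (k : ℕ) : (PresentedGroup.of (rels := triangleRels r m p) false *
      PresentedGroup.of true) ^ (m * k) =
        PresentedGroup.of false ^ ((∑ i ∈ Finset.range m, r ^ i) * k) := by
    rw [pow_mul, mul_pow_eq_pow_geom_sum_mul_pow (triangleRels_conj r m p),
      triangleRels_of_true_pow, mul_one, pow_mul]
  apply Nat.dvd_antisymm
  · apply orderOf_dvd_of_pow_eq_one
    rw [mul_comm q, hpow, mul_comm, ← hp, triangleRels_of_false_pow]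
  · obtain ⟨f, hfa, hfc⟩ := exists_triangleGroup_hom_zmod (r := r) (m := m) (p := p)
    have h := orderOf_map_dvd f (PresentedGroup.of false * PresentedGroup.of true)
    rw [map_mul, hfa, hfc, one_mul, orderOf_ofAdd_one_zmod] at h
    obtain ⟨k, hk⟩ := h
    have h1 := pow_orderOf_eq_one
      (PresentedGroup.of (rels := triangleRels r m p) false * PresentedGroup.of true)
    rw [hk, hpow, ← orderOf_dvd_iff_pow_eq_one, hc] at h1
    have h2 : q * (∑ i ∈ Finset.range m, r ^ i) ∣ (∑ i ∈ Finset.range m, r ^ i) * k :=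
      hp ▸ h1
    rw [mul_comm q] at h2
    rw [hk, mul_comm q]
    exact mul_dvd_mul_left m (Nat.dvd_of_mul_dvd_mul_left hS h2)

end TriangleGroup

theorem lt_geom_sum {r m : ℕ} (hr : 2 ≤ r) (hm : 2 ≤ m) :
    m < ∑ i ∈ Finset.range m, r ^ i := by
  calc m = ∑ _i ∈ Finset.range m, 1 := by simp
    _ < ∑ i ∈ Finset.range m, r ^ i :=
      Finset.sum_lt_sum (fun i _ => Nat.one_le_pow _ _ (by omega))
        ⟨1, Finset.mem_range.mpr (by omega), by simp; omega⟩

/-- For `r ≥ 3`, `m ≥ 4`, `p = r^m - 1`, in the group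
`G = ⟨a, c | a^m = 1, c^p = 1, a·c·a⁻¹ = c^r⟩ ≅ ℤ/p ⋊ ℤ/m`, setting `b = a⁻¹·c⁻¹`
(so `a·b·c = 1`), the orders of `a`, `b`, `c` are exactly `m`, `(r-1)·m` and
`p = r^m - 1`, and these are pairwise distinct: `m < (r-1)·m < r^m - 1`. -/
theorem orders_of_triangle_group_generators (r m : ℕ) (hr : 3 ≤ r) (hm : 4 ≤ m)
    (p : ℕ) (hp : p = r ^ m - 1) :
    orderOf (PresentedGroup.of (rels := triangleRels r m p) true) = m ∧
    orderOf ((PresentedGroup.of (rels := triangleRels r m p) true)⁻¹ *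
      (PresentedGroup.of (rels := triangleRels r m p) false)⁻¹) = (r - 1) * m ∧
    orderOf (PresentedGroup.of (rels := triangleRels r m p) false) = p ∧
    m < (r - 1) * m ∧ (r - 1) * m < r ^ m - 1 := by
  have hS := lt_geom_sum (r := r) (m := m) (by omega) (by omega)
  have hgeom : r ^ m - 1 = (r - 1) * ∑ i ∈ Finset.range m, r ^ i := by
    have h := Nat.geomSum_eq (m := r) (by omega) m
    have hdvd : r - 1 ∣ r ^ m - 1 := by simpa using Nat.sub_dvd_pow_sub_pow r 1 m
    rw [h, Nat.mul_div_cancel' hdvd]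
  have hrm : (r : ZMod p) ^ m = 1 := by
    have h : r ^ m = p + 1 := by
      have := Nat.one_le_pow m r (by omega)
      omega
    simpa using congrArg (Nat.cast : ℕ → ZMod p) h
  have hc := orderOf_triangleGroup_of_false (by omega) hrm
  refine ⟨orderOf_triangleGroup_of_true, ?_, hc, ?_, ?_⟩
  · rw [← mul_inv_rev, orderOf_inv]
    exact orderOf_triangleGroup_mul hc (hp.trans hgeom) (by omega)
  · exact lt_mul_of_one_lt_left (by omega) (by omega)
  · rw [hgeom]
    exact Nat.mul_lt_mul_of_pos_left hS (by omega)
end
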